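/- The cuboctahedron is a nontile: there is no locally finite face-to-face tiling of ℝ³ by convex 3-polytopes each combinatorially equivalent to the cuboctahedron C, where C is the convex hull of the 12 midpoints of the edges of the cube [−1,1]³, i.e. of the points obtained from (1,1,0) by all permutations of coordinates and all changes of sign. -/

import Mathlib

open Set

noncomputable section

abbrev Euc (d : ℕ) := EuclideanSpace ℝ (Fin d)

/-- A tiling of `ℝ^d`: a family of closed sets covering the space with pairwise
disjoint interiors. -/
def IsTiling {d : ℕ} (𝒯 : Set (Set (Euc d))) : Prop :=
  (∀ T ∈ 𝒯, IsClosed T) ∧ ⋃₀ 𝒯 = Set.univ ∧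
    𝒯.Pairwise fun S T => interior S ∩ interior T = ∅

/-- Local finiteness: every compact set meets only finitely many tiles. -/
def LocallyFiniteTiling {d : ℕ} (𝒯 : Set (Set (Euc d))) : Prop :=
  ∀ K : Set (Euc d), IsCompact K → {T ∈ 𝒯 | (T ∩ K).Nonempty}.Finite

/-- `S` is an isometric copy of `T`. -/
def IsometricCopy {d : ℕ} (S T : Set (Euc d)) : Prop :=
  ∃ g : Euc d ≃ᵢ Euc d, g '' T = S

/-- A monohedral tiling with prototile `T`. -/
def Monohedral {d : ℕ} (𝒯 : Set (Set (Euc d))) (T : Set (Euc d)) : Prop :=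
  ∀ S ∈ 𝒯, IsometricCopy S T

/-- A convex `d`-polytope in `ℝ^d`: convex hull of a finite set, with nonempty interior. -/
def IsConvexPolytope {d : ℕ} (P : Set (Euc d)) : Prop :=
  (∃ V : Finset (Euc d), P = convexHull ℝ (V : Set (Euc d))) ∧ (interior P).Nonempty

/-- A tiling is face-to-face if the intersection of any two distinct tiles is a
face (extreme subset), possibly empty, of each of them. -/
def FaceToFace {d : ℕ} (𝒯 : Set (Set (Euc d))) : Prop :=
  ∀ S ∈ 𝒯, ∀ T ∈ 𝒯, S ≠ T → IsExtreme ℝ S (S ∩ T) ∧ IsExtreme ℝ T (S ∩ T)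

/-- Combinatorial equivalence: an order isomorphism between the face posets
(posets of extreme subsets ordered by inclusion). -/
def CombEquiv {d e : ℕ} (P : Set (Euc d)) (Q : Set (Euc e)) : Prop :=
  Nonempty ({F : Set (Euc d) // IsExtreme ℝ P F} ≃o {F : Set (Euc e) // IsExtreme ℝ Q F})

/-- A facet: a maximal proper nonempty face. -/
def IsFacet {d : ℕ} (Q F : Set (Euc d)) : Prop :=
  IsExtreme ℝ Q F ∧ F.Nonempty ∧ F ≠ Q ∧
    ∀ G : Set (Euc d), IsExtreme ℝ Q G → G ≠ Q → F ⊆ G → G = F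


/-- The cuboctahedron: the convex hull of the 12 points obtained from `(1,1,0)` by
permuting coordinates and changing signs, i.e. the midpoints of the edges of the
cube `[-1,1]³`. -/
def cuboctahedron : Set (Euc 3) :=
  convexHull ℝ {x : Euc 3 | ∃ i : Fin 3, x i = 0 ∧ ∀ j, j ≠ i → x j = 1 ∨ x j = -1}

section Polytope

variable {E : Type*} [NormedAddCommGroup E] [NormedSpace ℝ E]

/-- The convex hull of a finite set, with no condition on its dimension. -/
def IsPolytope (P : Set E) : Prop := ∃ V : Finset E, P = convexHull ℝ (V : Set E)

/-- A nonempty convex extreme subset. -/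
structure IsFace (P F : Set E) : Prop where
  isExtreme : IsExtreme ℝ P F
  convex : Convex ℝ F
  nonempty : F.Nonempty

/-- The number of vertices. -/
def vertexCount (F : Set E) : ℕ := (F.extremePoints ℝ).ncard

/-- If the weights of `x` dominate a positive multiple of the weights of `y`, the segment from `y`
to `x` can be prolonged inside the hull. -/
theorem exists_mem_openSegment_of_weights {V : Finset E} {w w' : E → ℝ} {t : ℝ} (ht : 0 < t)
    (hw : ∑ i ∈ V, w i = 1) (hw' : ∑ i ∈ V, w' i = 1) (h : ∀ i ∈ V, t * w' i ≤ (1 + t) * w i) :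
    ∃ z ∈ convexHull ℝ (V : Set E),
      ∑ i ∈ V, w i • i ∈ openSegment ℝ (∑ i ∈ V, w' i • i) z := by
  refine ⟨∑ i ∈ V, ((1 + t) * w i - t * w' i) • i, Finset.mem_convexHull'.2
    ⟨_, fun i hi ↦ sub_nonneg.2 (h i hi), ?_, rfl⟩, t / (1 + t), 1 / (1 + t), by positivity,
    by positivity, by field_simp; ring, ?_⟩
  · rw [Finset.sum_sub_distrib, ← Finset.mul_sum, ← Finset.mul_sum, hw, hw']
    ring
  · simp only [sub_smul, Finset.sum_sub_distrib, mul_smul, ← Finset.smul_sum]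
    rw [smul_sub, smul_smul, smul_smul, div_mul_cancel₀ _ (by positivity : (1 + t) ≠ 0), one_smul,
      div_mul_eq_mul_div, one_mul, add_sub_cancel]

theorem IsPolytope.convex {P : Set E} (hP : IsPolytope P) : Convex ℝ P := by
  obtain ⟨V, rfl⟩ := hP
  exact convex_convexHull ℝ _

theorem IsPolytope.isCompact {P : Set E} (hP : IsPolytope P) : IsCompact P := by
  obtain ⟨V, rfl⟩ := hP
  exact V.finite_toSet.isCompact_convexHull ℝ

theorem IsPolytope.finite_extremePoints {P : Set E} (hP : IsPolytope P) :
    (P.extremePoints ℝ).Finite := by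
  obtain ⟨V, rfl⟩ := hP
  exact V.finite_toSet.subset extremePoints_convexHull_subset

theorem IsPolytope.convexHull_extremePoints {P : Set E} (hP : IsPolytope P) :
    convexHull ℝ (P.extremePoints ℝ) = P := by
  rw [← (hP.finite_extremePoints.isClosed_convexHull ℝ).closure_eq,
    closure_convexHull_extremePoints hP.isCompact hP.convex]

theorem IsExtreme.subset_convexHull_inter {V : Finset E} {F : Set E}
    (hF : IsExtreme ℝ (convexHull ℝ (V : Set E)) F) : F ⊆ convexHull ℝ (F ∩ V) := by
  classical
  intro x hx
  obtain ⟨w, hw0, hw1, rfl⟩ := Finset.mem_convexHull'.1 (hF.subset hx)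
  have key : ∀ y ∈ V, 0 < w y → y ∈ F := by
    intro y hy hwy
    obtain ⟨z, hz, hxz⟩ := exists_mem_openSegment_of_weights (w' := Pi.single y 1) hwy hw1
      (by simp [Pi.single_apply, hy]) (by
        intro i hi
        rcases eq_or_ne i y with rfl | h
        · simp only [Pi.single_eq_same]
          nlinarith
        · simp only [Pi.single_eq_of_ne h, mul_zero]
          exact mul_nonneg (by linarith) (hw0 i hi))
    have hy' : ∑ i ∈ V, (Pi.single y 1 : E → ℝ) i • i = y := by
      simp [Pi.single_apply, ite_smul, hy]
    rw [hy'] at hxz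
    exact hF.left_mem_of_mem_openSegment (subset_convexHull ℝ _ hy) hz hx hxz
  have hfil : ∀ i ∈ V, i ∉ V.filter (fun i ↦ 0 < w i) → w i = 0 := fun i hi hi' ↦
    le_antisymm (not_lt.1 fun h ↦ hi' (Finset.mem_filter.2 ⟨hi, h⟩)) (hw0 i hi)
  rw [← Finset.sum_subset (Finset.filter_subset _ V) fun i hi hi' ↦ by
    rw [hfil i hi hi', zero_smul]]
  refine (convex_convexHull ℝ _).sum_mem (fun i hi ↦ hw0 i (Finset.mem_filter.1 hi).1) ?_
    fun i hi ↦ subset_convexHull ℝ _ ⟨?_, (Finset.mem_filter.1 hi).1⟩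
  · rw [Finset.sum_subset (Finset.filter_subset _ V) hfil, hw1]
  · exact key i (Finset.mem_filter.1 hi).1 (Finset.mem_filter.1 hi).2

theorem IsFace.isPolytope {P F : Set E} (hP : IsPolytope P) (hF : IsFace P F) :
    IsPolytope F := by
  classical
  obtain ⟨V, rfl⟩ := hP
  refine ⟨V.filter (· ∈ F), Subset.antisymm ?_ (convexHull_min ?_ hF.convex)⟩
  · refine hF.isExtreme.subset_convexHull_inter.trans (convexHull_mono fun x hx ↦ ?_)
    simpa using ⟨hx.2, hx.1⟩
  · intro x hx
    simp only [Finset.coe_filter, mem_ofPred_eq] at hx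
    exact hx.2

theorem IsFace.extremePoints_subset {P F : Set E} (hF : IsFace P F) :
    F.extremePoints ℝ ⊆ P.extremePoints ℝ := hF.isExtreme.extremePoints_subset_extremePoints

theorem IsFace.subset_of_extremePoints_subset {P F G : Set E} (hP : IsPolytope P)
    (hF : IsFace P F) (hG : Convex ℝ G) (h : F.extremePoints ℝ ⊆ G) : F ⊆ G := by
  rw [← (hF.isPolytope hP).convexHull_extremePoints]
  exact convexHull_min h hG

theorem IsPolytope.finite_isFace {P : Set E} (hP : IsPolytope P) : {F | IsFace P F}.Finite := by
  refine (hP.finite_extremePoints.finite_subsets.image (convexHull ℝ)).subset fun F hF ↦ ?_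
  exact ⟨_, hF.extremePoints_subset, (hF.isPolytope hP).convexHull_extremePoints⟩

theorem IsPolytope.nonempty_extremePoints {P : Set E} (hP : IsPolytope P) (h : P.Nonempty) :
    (P.extremePoints ℝ).Nonempty := hP.isCompact.extremePoints_nonempty h

/-- A polytope has a point from which every segment can be prolonged in the polytope. -/
theorem IsPolytope.exists_forall_mem_openSegment {F : Set E} (hF : IsPolytope F)
    (hne : F.Nonempty) : ∃ x ∈ F, ∀ y ∈ F, ∃ z ∈ F, x ∈ openSegment ℝ y z := by
  obtain ⟨V, rfl⟩ := hF
  have hV : V.Nonempty := by simpa using hne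
  have hn : 0 < (V.card : ℝ) := by exact_mod_cast hV.card_pos
  have h1 : ∑ i ∈ V, (V.card : ℝ)⁻¹ = 1 := by
    rw [Finset.sum_const, nsmul_eq_mul, mul_inv_cancel₀ hn.ne']
  refine ⟨∑ i ∈ V, (V.card : ℝ)⁻¹ • i,
    Finset.mem_convexHull'.2 ⟨fun _ ↦ (V.card : ℝ)⁻¹, fun _ _ ↦ by positivity, h1, rfl⟩,
    fun y hy ↦ ?_⟩
  obtain ⟨w, hw0, hw1, rfl⟩ := Finset.mem_convexHull'.1 hy
  refine exists_mem_openSegment_of_weights (inv_pos.2 hn) h1 hw1 fun i hi ↦ ?_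
  have hi1 : w i ≤ 1 := hw1 ▸ Finset.single_le_sum hw0 hi
  have := inv_pos.2 hn
  nlinarith

theorem IsExtreme.subset_of_forall_mem_openSegment {P F G : Set E} {x : E}
    (hG : IsExtreme ℝ P G) (hFP : F ⊆ P) (hx : ∀ y ∈ F, ∃ z ∈ F, x ∈ openSegment ℝ y z)
    (hxG : x ∈ G) : F ⊆ G := fun y hy ↦ by
  obtain ⟨z, hz, h⟩ := hx y hy
  exact hG.left_mem_of_mem_openSegment (hFP hy) (hFP hz) hxG h

/-- The smallest extreme set containing a given point of a convex set is a face. -/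
theorem Convex.isFace_setOf_mem_openSegment {P : Set E} (hP : Convex ℝ P) {x : E} (hx : x ∈ P) :
    IsFace P {y ∈ P | ∃ z ∈ P, x ∈ openSegment ℝ y z} := by
  refine ⟨⟨sep_subset _ _, ?_⟩, ?_, x, hx, x, hx, by simp⟩
  · rintro a ha b hb y ⟨hy, z, hz, s, t, hs, ht, hst, rfl⟩ ⟨p, q, hp, hq, hpq, rfl⟩
    have hc : 0 < s * q + t := by positivity
    refine ⟨ha, (s * q + t)⁻¹ • ((s * q) • b + t • z), ?_, s * p, s * q + t, by positivity, hc,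
      by linear_combination s * hpq + hst, ?_⟩
    · rw [smul_add, smul_smul, smul_smul]
      exact hP hb hz (by positivity) (by positivity) (by field_simp)
    · rw [smul_smul, mul_inv_cancel₀ hc.ne', one_smul, smul_add, smul_smul, smul_smul]
      abel
  · rintro a ⟨ha, z, hz, s, t, hs, ht, hst, hxs⟩ b ⟨hb, z', hz', s', t', hs', ht', hst', hxs'⟩
      p q hp hq hpq
    refine ⟨hP ha hb hp hq hpq, ?_⟩
    have hc : 0 < p * s' + q * s := by
      rcases hp.eq_or_lt with rfl | h
      · simp only [zero_add] at hpq
        subst hpq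
        linarith
      · positivity
    have hd : 0 < p * s' * t + q * s * t' := by
      rcases hp.eq_or_lt with rfl | h
      · simp only [zero_add] at hpq
        subst hpq
        simp only [zero_mul, one_mul, zero_add]
        positivity
      · positivity
    have hsum : p * s' + q * s = s * s' + (p * s' * t + q * s * t') := by
      linear_combination (p * s') * (-hst) + (q * s) * (-hst') + (s * s') * hpq
    refine ⟨(p * s' * t + q * s * t')⁻¹ • ((p * s' * t) • z + (q * s * t') • z'), ?_,
      s * s' / (p * s' + q * s), (p * s' * t + q * s * t') / (p * s' + q * s), by positivity,
      by positivity, ?_, ?_⟩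
    · rw [smul_add, smul_smul, smul_smul]
      exact hP hz hz' (by positivity) (by positivity) (by field_simp)
    · rw [← add_div, ← hsum, div_self hc.ne']
    · have hx : (p * s' + q * s) • x =
          (p * s') • (s • a + t • z) + (q * s) • (s' • b + t' • z') := by
        rw [hxs, hxs', add_smul]
      rw [← inv_smul_smul₀ hc.ne' x, hx, div_eq_inv_mul, div_eq_inv_mul, mul_smul _ (s * s'),
        mul_smul _ (p * s' * t + q * s * t'), smul_inv_smul₀ hd.ne', ← smul_add]
      congr 1
      module

end Polytope

section Transfer

/-- An element with a largest element strictly below it. -/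
def HasLargestBelow {α : Type*} [Preorder α] (a : α) : Prop := ∃ b < a, ∀ c < a, c ≤ b

theorem OrderIso.hasLargestBelow_iff {α β : Type*} [Preorder α] [Preorder β] (φ : α ≃o β) {a : α} :
    HasLargestBelow (φ a) ↔ HasLargestBelow a := by
  constructor
  · rintro ⟨b, hb, h⟩
    exact ⟨φ.symm b, by simpa [φ.symm_apply_lt] using hb,
      fun c hc ↦ φ.le_symm_apply.2 (h _ (φ.lt_iff_lt.2 hc))⟩
  · rintro ⟨b, hb, h⟩
    exact ⟨φ b, φ.lt_iff_lt.2 hb, fun c hc ↦ φ.symm_apply_le.1 (h _ (φ.symm_apply_lt.2 hc))⟩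

variable {E E' : Type*} [NormedAddCommGroup E] [NormedSpace ℝ E] [NormedAddCommGroup E']
  [NormedSpace ℝ E']

theorem IsPolytope.hasLargestBelow_iff {P : Set E} (hP : IsPolytope P)
    (F : {F : Set E // IsExtreme ℝ P F}) : HasLargestBelow F ↔ IsFace P F.1 := by
  constructor
  · rintro ⟨G, hGF, hG⟩
    obtain ⟨x, hxF, hxG⟩ := exists_of_ssubset hGF
    have hx := hP.convex.isFace_setOf_mem_openSegment (F.2.subset hxF)
    set H := {y ∈ P | ∃ z ∈ P, x ∈ openSegment ℝ y z}
    have hxH : x ∈ H := ⟨F.2.subset hxF, x, F.2.subset hxF, by simp⟩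
    have hHF : H ⊆ F.1 := fun y ⟨hy, z, hz, hxz⟩ ↦
      F.2.left_mem_of_mem_openSegment hy hz hxF hxz
    rcases hHF.eq_or_ssubset with h | h
    · exact h ▸ hx
    · exact absurd (hG ⟨H, hx.isExtreme⟩ h hxH) hxG
  · intro hF
    obtain ⟨x, hxF, hx⟩ := (hF.isPolytope hP).exists_forall_mem_openSegment hF.nonempty
    refine ⟨⟨⋃₀ {H | IsExtreme ℝ P H ∧ H ⊆ F.1 ∧ x ∉ H}, ⟨?_, ?_⟩⟩, ?_, ?_⟩
    · exact sUnion_subset fun H hH ↦ hH.1.subset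
    · rintro a ha b hb z ⟨H, hH, hz⟩ hzab
      exact ⟨H, hH, hH.1.left_mem_of_mem_openSegment ha hb hz hzab⟩
    · refine Set.ssubset_iff_exists.2 ⟨sUnion_subset fun H hH ↦ hH.2.1, x, hxF, ?_⟩
      rintro ⟨H, hH, hxH⟩
      exact hH.2.2 hxH
    · intro H hH
      refine subset_sUnion_of_mem (show H.1 ∈ _ from ⟨H.2, hH.le, fun hxH ↦ ?_⟩)
      exact hH.not_ge (H.2.subset_of_forall_mem_openSegment F.2.subset hx hxH)

theorem isFace_singleton {P : Set E} {v : E} (hv : v ∈ P.extremePoints ℝ) : IsFace P {v} :=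
  ⟨isExtreme_singleton.2 hv, convex_singleton v, singleton_nonempty v⟩

theorem IsPolytope.minimal_hasLargestBelow_iff {P : Set E} (hP : IsPolytope P)
    (F : {F : Set E // IsExtreme ℝ P F}) :
    Minimal HasLargestBelow F ↔ ∃ v ∈ P.extremePoints ℝ, F.1 = {v} := by
  constructor
  · rintro ⟨hF, hmin⟩
    rw [hP.hasLargestBelow_iff] at hF
    obtain ⟨v, hv⟩ := (hF.isPolytope hP).nonempty_extremePoints hF.nonempty
    have hvP := hF.extremePoints_subset hv
    refine ⟨v, hvP, Subset.antisymm ?_ (singleton_subset_iff.2 hv.1)⟩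
    exact hmin (y := ⟨{v}, isExtreme_singleton.2 hvP⟩)
      ((hP.hasLargestBelow_iff _).2 (isFace_singleton hvP)) (singleton_subset_iff.2 hv.1)
  · rintro ⟨v, hv, h⟩
    refine ⟨(hP.hasLargestBelow_iff _).2 (h ▸ isFace_singleton hv), fun G hG hGF ↦ ?_⟩
    have hGF' : G.1 ⊆ {v} := h ▸ hGF
    have := (((hP.hasLargestBelow_iff _).1 hG).nonempty.subset_singleton_iff).1 hGF'
    exact (h.trans this.symm).subset

theorem IsPolytope.vertexCount_eq {P : Set E} (hP : IsPolytope P)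
    (F : {F : Set E // IsExtreme ℝ P F}) :
    vertexCount F.1 = {G | Minimal HasLargestBelow G ∧ G ≤ F}.ncard := by
  refine Set.ncard_congr (fun v hv ↦ ⟨{v}, F.2.trans (isExtreme_singleton.2 hv)⟩) ?_ ?_ ?_
  · intro v hv
    refine ⟨(hP.minimal_hasLargestBelow_iff _).2 ⟨v, ?_, rfl⟩, singleton_subset_iff.2 hv.1⟩
    exact F.2.extremePoints_subset_extremePoints hv
  · intro v w _ _ h
    simpa using h
  · rintro G ⟨hG, hGF⟩
    obtain ⟨v, hv, h⟩ := (hP.minimal_hasLargestBelow_iff _).1 hG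
    refine ⟨v, ?_, Subtype.ext h.symm⟩
    rw [F.2.extremePoints_eq]
    exact ⟨hGF (h ▸ mem_singleton v), hv⟩

theorem IsPolytope.isFace_orderIso {P : Set E} {Q : Set E'} (hP : IsPolytope P)
    (hQ : IsPolytope Q) (φ : {F : Set E // IsExtreme ℝ P F} ≃o {F : Set E' // IsExtreme ℝ Q F})
    {F : {F : Set E // IsExtreme ℝ P F}} : IsFace Q (φ F).1 ↔ IsFace P F.1 := by
  rw [← hP.hasLargestBelow_iff, ← hQ.hasLargestBelow_iff, φ.hasLargestBelow_iff]

theorem IsPolytope.vertexCount_orderIso {P : Set E} {Q : Set E'} (hP : IsPolytope P)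
    (hQ : IsPolytope Q) (φ : {F : Set E // IsExtreme ℝ P F} ≃o {F : Set E' // IsExtreme ℝ Q F})
    (F : {F : Set E // IsExtreme ℝ P F}) : vertexCount (φ F).1 = vertexCount F.1 := by
  have hmin : ∀ G, Minimal HasLargestBelow (φ G) ↔ Minimal HasLargestBelow G := fun G ↦
    and_congr φ.hasLargestBelow_iff ⟨fun h y hy hyG ↦ φ.le_iff_le.1
      (h (φ.hasLargestBelow_iff.2 hy) (φ.le_iff_le.2 hyG)), fun h ↦ φ.surjective.forall.2
      fun y hy hyG ↦ φ.le_iff_le.2 (h (φ.hasLargestBelow_iff.1 hy) (φ.le_iff_le.1 hyG))⟩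
  rw [hP.vertexCount_eq, hQ.vertexCount_eq, ← ncard_image_of_injective _ φ.injective]
  congr 1
  ext G
  constructor
  · rintro ⟨h, hG⟩
    exact ⟨φ.symm G, ⟨by rwa [← hmin, φ.apply_symm_apply], φ.symm_apply_le.2 hG⟩,
      φ.apply_symm_apply G⟩
  · rintro ⟨H, ⟨h, hG⟩, rfl⟩
    exact ⟨(hmin H).2 h, φ.le_iff_le.2 hG⟩

/-- The combinatorial properties of the cuboctahedron used below: there are more than four vertices
and at least four edges at each vertex; each edge lies in a face with three vertices and in a unique
face with four vertices; and no proper face contains faces of both kinds. -/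
structure IsCuboctahedral (P : Set E) : Prop where
  edges : ∀ F, IsFace P F → vertexCount F = 1 → ∃ S : Finset (Set E), S.card = 4 ∧
    ∀ e ∈ S, IsFace P e ∧ vertexCount e = 2 ∧ F ⊆ e
  triangle : ∀ e, IsFace P e → vertexCount e = 2 → ∃ F, IsFace P F ∧ vertexCount F = 3 ∧ e ⊆ F
  square : ∀ e, IsFace P e → vertexCount e = 2 → ∃ F, IsFace P F ∧ vertexCount F = 4 ∧ e ⊆ F
  square_unique : ∀ e F G, IsFace P e → vertexCount e = 2 → IsFace P F → vertexCount F = 4 →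
    IsFace P G → vertexCount G = 4 → e ⊆ F → e ⊆ G → F = G
  eq_of_subset : ∀ F G H, IsFace P F → vertexCount F = 3 → IsFace P G → vertexCount G = 4 →
    IsFace P H → F ⊆ H → G ⊆ H → H = P
  lt_vertexCount : 4 < vertexCount P

theorem IsCuboctahedral.of_orderIso {P : Set E} {Q : Set E'} (hP : IsPolytope P)
    (hQ : IsPolytope Q) (φ : {F : Set E // IsExtreme ℝ P F} ≃o {F : Set E' // IsExtreme ℝ Q F})
    (h : IsCuboctahedral Q) : IsCuboctahedral P := by
  classical
  obtain ⟨f, g, hf, hg, hfm, hgm, hfg⟩ : ∃ (f : Set E → Set E') (g : Set E' → Set E),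
      (∀ F, IsFace P F → IsFace Q (f F) ∧ vertexCount (f F) = vertexCount F ∧ g (f F) = F) ∧
      (∀ F, IsFace Q F → IsFace P (g F) ∧ vertexCount (g F) = vertexCount F ∧ f (g F) = F) ∧
      (∀ F G, IsFace P F → IsFace P G → F ⊆ G → f F ⊆ f G) ∧
      (∀ F G, IsFace Q F → IsFace Q G → F ⊆ G → g F ⊆ g G) ∧
      (∀ H, IsFace P H → f H = Q → H = P) := by
    refine ⟨fun F ↦ if hF : IsExtreme ℝ P F then (φ ⟨F, hF⟩).1 else ∅,
      fun F ↦ if hF : IsExtreme ℝ Q F then (φ.symm ⟨F, hF⟩).1 else ∅, ?_, ?_, ?_, ?_, ?_⟩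
    · intro F hF
      simp only [hF.isExtreme, dif_pos, (φ ⟨F, hF.isExtreme⟩).2, Subtype.coe_eta,
        φ.symm_apply_apply, and_true]
      exact ⟨(hP.isFace_orderIso hQ φ).2 hF, hP.vertexCount_orderIso hQ φ _⟩
    · intro F hF
      simp only [hF.isExtreme, dif_pos, (φ.symm ⟨F, hF.isExtreme⟩).2, Subtype.coe_eta,
        φ.apply_symm_apply, and_true]
      exact ⟨(hQ.isFace_orderIso hP φ.symm).2 hF, hQ.vertexCount_orderIso hP φ.symm _⟩
    · intro F G hF hG hFG
      simp only [hF.isExtreme, hG.isExtreme, dif_pos]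
      exact φ.monotone (show (⟨F, hF.isExtreme⟩ : {F : Set E // IsExtreme ℝ P F}) ≤
        ⟨G, hG.isExtreme⟩ from hFG)
    · intro F G hF hG hFG
      simp only [hF.isExtreme, hG.isExtreme, dif_pos]
      exact φ.symm.monotone (show (⟨F, hF.isExtreme⟩ : {F : Set E' // IsExtreme ℝ Q F}) ≤
        ⟨G, hG.isExtreme⟩ from hFG)
    · intro H hH hHQ
      simp only [hH.isExtreme, dif_pos] at hHQ
      refine Subset.antisymm hH.isExtreme.subset ?_
      have : (⟨P, .rfl⟩ : {F : Set E // IsExtreme ℝ P F}) ≤ ⟨H, hH.isExtreme⟩ := by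
        rw [← φ.le_iff_le]
        exact (φ ⟨P, .rfl⟩).2.subset.trans hHQ.superset
      exact this
  refine ⟨fun F hF h1 ↦ ?_, fun e he h2 ↦ ?_, fun e he h2 ↦ ?_, ?_, ?_, ?_⟩
  · obtain ⟨S, hS, hSe⟩ := h.edges _ (hf F hF).1 ((hf F hF).2.1.trans h1)
    refine ⟨S.image g, ?_, fun e he ↦ ?_⟩
    · rw [Finset.card_image_of_injOn, hS]
      intro a ha b hb hab
      rw [← (hg a (hSe a ha).1).2.2, ← (hg b (hSe b hb).1).2.2, hab]
    · obtain ⟨e, heS, rfl⟩ := Finset.mem_image.1 he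
      obtain ⟨h1, h2, h3⟩ := hSe e heS
      refine ⟨(hg e h1).1, (hg e h1).2.1.trans h2, ?_⟩
      rw [← (hf F hF).2.2]
      exact hgm _ _ (hf F hF).1 h1 h3
  · obtain ⟨F, hF, h3, h⟩ := h.triangle _ (hf e he).1 ((hf e he).2.1.trans h2)
    refine ⟨g F, (hg F hF).1, (hg F hF).2.1.trans h3, ?_⟩
    rw [← (hf e he).2.2]
    exact hgm _ _ (hf e he).1 hF h
  · obtain ⟨F, hF, h3, h⟩ := h.square _ (hf e he).1 ((hf e he).2.1.trans h2)
    refine ⟨g F, (hg F hF).1, (hg F hF).2.1.trans h3, ?_⟩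
    rw [← (hf e he).2.2]
    exact hgm _ _ (hf e he).1 hF h
  · intro e F G he h2 hF hF4 hG hG4 heF heG
    rw [← (hf F hF).2.2, ← (hf G hG).2.2]
    congr 1
    exact h.square_unique (f e) _ _ (hf e he).1 ((hf e he).2.1.trans h2) (hf F hF).1
      ((hf F hF).2.1.trans hF4) (hf G hG).1 ((hf G hG).2.1.trans hG4) (hfm _ _ he hF heF)
      (hfm _ _ he hG heG)
  · intro F G H hF hF3 hG hG4 hH hFH hGH
    exact hfg H hH (h.eq_of_subset (f F) (f G) _ (hf F hF).1 ((hf F hF).2.1.trans hF3) (hf G hG).1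
      ((hf G hG).2.1.trans hG4) (hf H hH).1 (hfm _ _ hF hH hFH) (hfm _ _ hG hH hGH))
  · have hφ : (φ ⟨P, .rfl⟩).1 = Q := by
      refine Subset.antisymm (φ ⟨P, .rfl⟩).2.subset ?_
      have : (⟨Q, .rfl⟩ : {F : Set E' // IsExtreme ℝ Q F}) ≤ φ ⟨P, .rfl⟩ := by
        rw [← φ.symm_apply_le]
        exact (φ.symm ⟨Q, .rfl⟩).2.subset
      exact this
    have := h.lt_vertexCount
    rwa [← hφ, hP.vertexCount_orderIso hQ φ] at this

end Transfer

namespace Cuboctahedron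

/-- The coordinates of the vertices. -/
def coord : Fin 12 → Fin 3 → ℤ :=
  ![![1, 1, 0], ![1, -1, 0], ![-1, 1, 0], ![-1, -1, 0], ![1, 0, 1], ![1, 0, -1],
    ![-1, 0, 1], ![-1, 0, -1], ![0, 1, 1], ![0, 1, -1], ![0, -1, 1], ![0, -1, -1]]

/-! Sets of vertices are encoded by the natural numbers below `2 ^ 12`, through binary digits. -/

/-- The vertex sets of the edges. -/
def edges : List ℕ :=
  [17, 18, 33, 34, 68, 72, 132, 136, 257, 260, 272, 320, 513, 516, 544, 640, 1026, 1032, 1040,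
    1088, 2050, 2056, 2080, 2176]

/-- The vertex sets of the triangular facets. -/
def triangles : List ℕ :=
  [273, 324, 545, 644, 1042, 1096, 2082, 2184]

/-- The vertex sets of the square facets. -/
def squares : List ℕ :=
  [51, 204, 773, 1360, 2720, 3082]

/-- Quadruples `(i, j, k, l)` for which vertices `i`, `j` have the same midpoint as `k`, `l`. -/
def midpointRelations : List (Fin 12 × Fin 12 × Fin 12 × Fin 12) :=
  [(0, 1, 4, 5), (0, 2, 8, 9), (0, 3, 1, 2), (1, 2, 4, 7), (4, 7, 5, 6), (5, 6, 8, 11), (8,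
    11, 9, 10), (0, 6, 2, 4), (0, 7, 2, 5), (0, 10, 1, 8), (0, 11, 1, 9), (1, 3, 10, 11), (1,
    6, 3, 4), (1, 7, 3, 5), (2, 3, 6, 7), (2, 10, 3, 8), (2, 11, 3, 9), (4, 6, 8, 10), (4, 9,
    5, 8), (4, 11, 5, 10), (5, 7, 9, 11), (6, 9, 7, 8), (6, 11, 7, 10)]

/-- The sum of the vertices in `m`. -/
def normal (m : ℕ) (j : Fin 3) : ℤ :=
  ((List.finRange 12).map fun i : Fin 12 ↦ if m.testBit i then coord i j else 0).sum

/-- The product of `normal m` and the vertex `i`. -/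
def height (m : ℕ) (i : Fin 12) : ℤ :=
  normal m 0 * coord i 0 + normal m 1 * coord i 1 + normal m 2 * coord i 2

/-- The number of vertices in `m`. -/
def size (m : ℕ) : ℕ := ((List.finRange 12).map fun i : Fin 12 ↦ (m.testBit i).toNat).sum

theorem coord_add_coord (r) (hr : r ∈ midpointRelations) (j : Fin 3) :
    coord r.1 j + coord r.2.1 j = coord r.2.2.1 j + coord r.2.2.2 j := by
  have h : midpointRelations.all fun r ↦ (List.finRange 3).all fun j ↦
      coord r.1 j + coord r.2.1 j == coord r.2.2.1 j + coord r.2.2.2 j := by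
    decide +kernel
  simpa using List.all_eq_true.1 (List.all_eq_true.1 h r hr) j (List.mem_finRange j)

/-- The functional `normal m` has maximum `c` on the vertices, attained exactly on `m`. -/
def Exposed (m : ℕ) (c : ℤ) : Prop :=
  ∀ i : Fin 12, height m i ≤ c ∧ (height m i = c ↔ m.testBit i = true)

instance (m : ℕ) (c : ℤ) : Decidable (Exposed m c) :=
  Nat.decidableForallFin _

theorem exposed_singleton : ∀ i : Fin 12, Exposed (2 ^ i.1) 2 := by decide +kernel

theorem exposed_edges : ∀ m ∈ edges, Exposed m 3 := by decide +kernel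

theorem exposed_triangles : ∀ m ∈ triangles, Exposed m 4 := by decide +kernel

theorem exposed_squares : ∀ m ∈ squares, Exposed m 4 := by decide +kernel

theorem size_edges : ∀ m ∈ edges, size m = 2 := by decide +kernel

theorem size_triangles : ∀ m ∈ triangles, size m = 3 := by decide +kernel

theorem size_squares : ∀ m ∈ squares, size m = 4 := by decide +kernel

theorem exists_edges : ∀ i : Fin 12, (edges.filter fun m ↦ m.testBit i).length = 4 := by
  decide +kernel

theorem nodup_edges : edges.Nodup := by decide +kernel

theorem edges_ext : ∀ m ∈ edges, ∀ m' ∈ edges,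
    (∀ i : Fin 12, m.testBit i = m'.testBit i) → m = m' := by decide +kernel

theorem exists_triangle : ∀ e ∈ edges, ∃ m ∈ triangles,
    ∀ i : Fin 12, e.testBit i → m.testBit i := by decide +kernel

theorem exists_square : ∀ e ∈ edges, ∃ m ∈ squares,
    ∀ i : Fin 12, e.testBit i → m.testBit i := by decide +kernel

theorem square_unique : ∀ e ∈ edges, ∀ m ∈ squares, ∀ m' ∈ squares,
    (∀ i : Fin 12, e.testBit i → m.testBit i) → (∀ i : Fin 12, e.testBit i → m'.testBit i) →
    m = m' := by decide +kernel

theorem size_triangle_or_square : ∀ m ∈ triangles, ∀ m' ∈ squares, 4 < size (m ||| m') := by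
  decide +kernel

theorem classification_all : (List.range 4096).all fun m ↦
    (!midpointRelations.all fun r ↦
      (m.testBit r.1 && m.testBit r.2.1) == (m.testBit r.2.2.1 && m.testBit r.2.2.2)) ||
    (m == 4095) || edges.contains m || triangles.contains m || squares.contains m ||
    decide (size m ≤ 1) := by
  decide +kernel

/-- The vertices. -/
def point (i : Fin 12) : Euc 3 := WithLp.toLp 2 fun j ↦ (coord i j : ℝ)

theorem cuboctahedron_eq : cuboctahedron = convexHull ℝ (range point) := by
  unfold cuboctahedron
  congr 1
  ext x
  constructor
  · have key : ∀ i : Fin 12, (∀ j, x j = coord i j) → x ∈ range point := fun i h ↦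
      ⟨i, by ext j; simp [point, h]⟩
    rintro ⟨i, hi, h⟩
    obtain rfl | rfl | rfl : i = 0 ∨ i = 1 ∨ i = 2 := by fin_cases i <;> simp
    · rcases h 1 (by decide) with h1 | h1 <;> rcases h 2 (by decide) with h2 | h2
      · exact key 8 (by simp [Fin.forall_fin_succ, coord, hi, h1, h2])
      · exact key 9 (by simp [Fin.forall_fin_succ, coord, hi, h1, h2])
      · exact key 10 (by simp [Fin.forall_fin_succ, coord, hi, h1, h2])
      · exact key 11 (by simp [Fin.forall_fin_succ, coord, hi, h1, h2])
    · rcases h 0 (by decide) with h1 | h1 <;> rcases h 2 (by decide) with h2 | h2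
      · exact key 4 (by simp [Fin.forall_fin_succ, coord, hi, h1, h2])
      · exact key 5 (by simp [Fin.forall_fin_succ, coord, hi, h1, h2])
      · exact key 6 (by simp [Fin.forall_fin_succ, coord, hi, h1, h2])
      · exact key 7 (by simp [Fin.forall_fin_succ, coord, hi, h1, h2])
    · rcases h 0 (by decide) with h1 | h1 <;> rcases h 1 (by decide) with h2 | h2
      · exact key 0 (by simp [Fin.forall_fin_succ, coord, hi, h1, h2])
      · exact key 1 (by simp [Fin.forall_fin_succ, coord, hi, h1, h2])
      · exact key 2 (by simp [Fin.forall_fin_succ, coord, hi, h1, h2])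
      · exact key 3 (by simp [Fin.forall_fin_succ, coord, hi, h1, h2])
  · rintro ⟨i, rfl⟩
    have h : ∀ i, ∃ k, coord i k = 0 ∧ ∀ j, j ≠ k → coord i j = 1 ∨ coord i j = -1 := by
      decide +kernel
    obtain ⟨k, hk, hj⟩ := h i
    exact ⟨k, by simp [point, hk], fun j hjk ↦ (hj j hjk).imp (fun h ↦ by simp [point, h])
      fun h ↦ by simp [point, h]⟩

theorem point_mem (i : Fin 12) : point i ∈ cuboctahedron :=
  cuboctahedron_eq ▸ subset_convexHull ℝ _ (mem_range_self i)

theorem isPolytope : IsPolytope cuboctahedron :=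
  ⟨Finset.univ.image point, by rw [cuboctahedron_eq]; simp⟩

theorem coord_injective : Function.Injective coord := by decide +kernel

theorem point_injective : Function.Injective point := fun i j h ↦ coord_injective <| by
  ext k
  have : ((coord i k : ℤ) : ℝ) = coord j k := congrFun (congrArg WithLp.ofLp h) k
  exact_mod_cast this

/-- The functional given by `normal m`. -/
def functional (m : ℕ) : Euc 3 →L[ℝ] ℝ := ∑ j, (normal m j : ℝ) • EuclideanSpace.proj j

theorem functional_point (m : ℕ) (i : Fin 12) : functional m (point i) = height m i := by
  simp [functional, height, point, Fin.sum_univ_three]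

/-- The face on which the functional given by `normal m` is maximal. -/
def face (m : ℕ) : Set (Euc 3) :=
  {x ∈ cuboctahedron | ∀ y ∈ cuboctahedron, functional m y ≤ functional m x}

theorem Exposed.point_mem_face {m : ℕ} {c : ℤ} (h : Exposed m c) (hm : ∃ i : Fin 12, m.testBit i)
    (i : Fin 12) : point i ∈ face m ↔ m.testBit i := by
  have hle : ∀ y ∈ cuboctahedron, functional m y ≤ c := by
    rw [cuboctahedron_eq]
    refine fun y hy ↦ convexHull_min (t := {y | functional m y ≤ c}) ?_ ?_ hy
    · rintro _ ⟨i, rfl⟩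
      simpa [functional_point] using (h i).1
    · exact convex_halfSpace_le (functional m).isLinear _
  rw [← (h i).2]
  constructor
  · rintro ⟨-, hi⟩
    obtain ⟨k, hk⟩ := hm
    have := hi _ (point_mem k)
    rw [functional_point, functional_point, (h k).2.2 hk] at this
    exact le_antisymm (h i).1 (by exact_mod_cast this)
  · intro hi
    refine ⟨point_mem i, fun y hy ↦ ?_⟩
    rw [functional_point, hi]
    exact hle y hy

theorem Exposed.isFace {m : ℕ} {c : ℤ} (h : Exposed m c) (hm : ∃ i : Fin 12, m.testBit i) :
    IsFace cuboctahedron (face m) := by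
  have : IsExposed ℝ cuboctahedron (face m) := fun _ ↦ ⟨functional m, rfl⟩
  obtain ⟨i, hi⟩ := hm
  exact ⟨this.isExtreme, this.convex isPolytope.convex, point i, (h.point_mem_face ⟨i, hi⟩ i).2 hi⟩

theorem extremePoints_eq : cuboctahedron.extremePoints ℝ = range point := by
  have hsub : cuboctahedron.extremePoints ℝ ⊆ range point := by
    rw [cuboctahedron_eq]
    exact extremePoints_convexHull_subset
  refine hsub.antisymm ?_
  rintro _ ⟨i, rfl⟩
  have hm : ∃ k : Fin 12, (2 ^ i.1).testBit k := ⟨i, by simp⟩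
  have hF := (exposed_singleton i).isFace hm
  obtain ⟨x, hx⟩ := (hF.isPolytope isPolytope).nonempty_extremePoints hF.nonempty
  obtain ⟨k, rfl⟩ := hsub (hF.extremePoints_subset hx)
  have := ((exposed_singleton i).point_mem_face hm k).1 hx.1
  rw [Nat.testBit_two_pow, decide_eq_true_eq] at this
  rw [Fin.ext this]
  exact hF.extremePoints_subset hx

theorem size_eq (m : ℕ) : size m = ∑ i : Fin 12, (m.testBit i).toNat := by
  rw [size, Fin.sum_univ_def]

theorem size_mono {m m' : ℕ} (h : ∀ i : Fin 12, m.testBit i → m'.testBit i) :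
    size m ≤ size m' := by
  rw [size_eq, size_eq]
  exact Finset.sum_le_sum fun i _ ↦ Bool.toNat_le_toNat (h i)

theorem extremePoints_face {F : Set (Euc 3)} (hF : IsFace cuboctahedron F) :
    F.extremePoints ℝ = point '' {i | point i ∈ F} := by
  rw [hF.isExtreme.extremePoints_eq, extremePoints_eq, ← image_preimage_eq_inter_range,
    preimage]

theorem vertexCount_eq_size {F : Set (Euc 3)} (hF : IsFace cuboctahedron F) {m : ℕ}
    (h : ∀ i : Fin 12, point i ∈ F ↔ m.testBit i) : vertexCount F = size m := by
  rw [vertexCount, extremePoints_face hF, ncard_image_of_injective _ point_injective, size_eq]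
  simp_rw [h]
  rw [ncard_eq_toFinset_card', toFinset_ofPred, Finset.card_filter]
  exact Finset.sum_congr rfl fun i _ ↦ by cases m.testBit i <;> simp

theorem subset_iff {F G : Set (Euc 3)} (hF : IsFace cuboctahedron F)
    (hG : IsFace cuboctahedron G) {m m' : ℕ} (h : ∀ i : Fin 12, point i ∈ F ↔ m.testBit i)
    (h' : ∀ i : Fin 12, point i ∈ G ↔ m'.testBit i) :
    F ⊆ G ↔ ∀ i : Fin 12, m.testBit i → m'.testBit i := by
  simp_rw [← h, ← h']
  refine ⟨fun hFG i hi ↦ hFG hi,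
    fun hFG ↦ hF.subset_of_extremePoints_subset isPolytope hG.convex ?_⟩
  rw [extremePoints_face hF]
  rintro _ ⟨i, hi, rfl⟩
  exact hFG i hi

theorem point_mem_of_isFace {F : Set (Euc 3)} (hF : IsFace cuboctahedron F)
    {r : Fin 12 × Fin 12 × Fin 12 × Fin 12}
    (hr : ∀ j, coord r.1 j + coord r.2.1 j = coord r.2.2.1 j + coord r.2.2.2 j)
    (h1 : point r.1 ∈ F) (h2 : point r.2.1 ∈ F) : point r.2.2.1 ∈ F ∧ point r.2.2.2 ∈ F := by
  have h : midpoint ℝ (point r.1) (point r.2.1) = midpoint ℝ (point r.2.2.1) (point r.2.2.2) := by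
    rw [midpoint_eq_smul_add, midpoint_eq_smul_add]
    congr 1
    ext j
    simpa [point] using mod_cast hr j
  have hmem := hF.convex.midpoint_mem h1 h2
  have hseg : midpoint ℝ (point r.2.2.1) (point r.2.2.2) ∈
      openSegment ℝ (point r.2.2.1) (point r.2.2.2) :=
    ⟨1 / 2, 1 / 2, by norm_num, by norm_num, by norm_num, by
      rw [midpoint_eq_smul_add, smul_add]; norm_num⟩
  rw [← h] at hseg
  exact ⟨hF.isExtreme.left_mem_of_mem_openSegment (point_mem _)
      (point_mem _) hmem hseg,
    hF.isExtreme.right_mem_of_mem_openSegment (point_mem _)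
      (point_mem _) hmem hseg⟩

theorem classification {F : Set (Euc 3)} (hF : IsFace cuboctahedron F) :
    ∃ m : ℕ, (∀ i : Fin 12, point i ∈ F ↔ m.testBit i) ∧
      (m = 4095 ∨ m ∈ edges ∨ m ∈ triangles ∨ m ∈ squares ∨ size m ≤ 1) := by
  classical
  set m := Nat.ofBits fun i : Fin 12 ↦ decide (point i ∈ F) with hm
  have hbit : ∀ i : Fin 12, point i ∈ F ↔ m.testBit i := fun i ↦ by
    rw [hm, Nat.testBit_ofBits_lt _ _ i.2]
    simp
  have hlt : m < 4096 := Nat.ofBits_lt_two_pow _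
  refine ⟨m, hbit, ?_⟩
  have h := List.all_eq_true.1 classification_all m (List.mem_range.2 hlt)
  have hrel : midpointRelations.all fun r ↦
      (m.testBit r.1 && m.testBit r.2.1) == (m.testBit r.2.2.1 && m.testBit r.2.2.2) := by
    refine List.all_eq_true.2 fun r hr ↦ ?_
    rw [beq_iff_eq, Bool.eq_iff_iff, Bool.and_eq_true, Bool.and_eq_true, ← hbit, ← hbit, ← hbit,
      ← hbit]
    exact ⟨fun h ↦ point_mem_of_isFace hF (coord_add_coord r hr) h.1 h.2, fun h ↦
      point_mem_of_isFace (r := (r.2.2.1, r.2.2.2, r.1, r.2.1)) hF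
        (fun j ↦ (coord_add_coord r hr j).symm) h.1 h.2⟩
  rw [hrel] at h
  simpa [or_assoc] using h

theorem exists_testBit {m : ℕ} (h : size m ≠ 0) : ∃ i : Fin 12, m.testBit i := by
  contrapose! h
  rw [size_eq]
  exact Finset.sum_eq_zero fun i _ ↦ by simpa using h i

theorem mem_edges_or {F : Set (Euc 3)} (hF : IsFace cuboctahedron F) (h : 1 < vertexCount F)
    (h4 : vertexCount F ≤ 4) : ∃ m : ℕ, (∀ i : Fin 12, point i ∈ F ↔ m.testBit i) ∧
      (vertexCount F = 2 ∧ m ∈ edges ∨ vertexCount F = 3 ∧ m ∈ triangles ∨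
        vertexCount F = 4 ∧ m ∈ squares) := by
  obtain ⟨m, hm, h'⟩ := classification hF
  refine ⟨m, hm, ?_⟩
  rw [vertexCount_eq_size hF hm] at h h4 ⊢
  have h12 : size 4095 = 12 := by decide +kernel
  rcases h' with rfl | h' | h' | h' | h'
  · omega
  · exact .inl ⟨size_edges m h', h'⟩
  · exact .inr (.inl ⟨size_triangles m h', h'⟩)
  · exact .inr (.inr ⟨size_squares m h', h'⟩)
  · omega

theorem mem_edges {F : Set (Euc 3)} (hF : IsFace cuboctahedron F) (h : vertexCount F = 2) :
    ∃ m ∈ edges, ∀ i : Fin 12, point i ∈ F ↔ m.testBit i := by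
  obtain ⟨m, hm, h'⟩ := mem_edges_or hF (by omega) (by omega)
  exact ⟨m, by grind, hm⟩

theorem mem_triangles {F : Set (Euc 3)} (hF : IsFace cuboctahedron F) (h : vertexCount F = 3) :
    ∃ m ∈ triangles, ∀ i : Fin 12, point i ∈ F ↔ m.testBit i := by
  obtain ⟨m, hm, h'⟩ := mem_edges_or hF (by omega) (by omega)
  exact ⟨m, by grind, hm⟩

theorem mem_squares {F : Set (Euc 3)} (hF : IsFace cuboctahedron F) (h : vertexCount F = 4) :
    ∃ m ∈ squares, ∀ i : Fin 12, point i ∈ F ↔ m.testBit i := by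
  obtain ⟨m, hm, h'⟩ := mem_edges_or hF (by omega) (by omega)
  exact ⟨m, by grind, hm⟩

theorem isCuboctahedral : IsCuboctahedral cuboctahedron := by
  classical
  have exists_face : ∀ {m : ℕ} {c : ℤ} {n : ℕ}, Exposed m c → size m = n → n ≠ 0 →
      IsFace cuboctahedron (face m) ∧ vertexCount (face m) = n ∧
        ∀ i : Fin 12, point i ∈ face m ↔ m.testBit i := fun hm hn h0 ↦ by
    have hF := hm.isFace (exists_testBit (hn ▸ h0))
    have h := hm.point_mem_face (exists_testBit (hn ▸ h0))
    exact ⟨hF, (vertexCount_eq_size hF h).trans hn, h⟩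
  have exists_edge := fun m hm ↦ exists_face (exposed_edges m hm) (size_edges m hm) two_ne_zero
  have h12 : size 4095 = 12 := by decide +kernel
  have hbit : ∀ i : Fin 12, (4095 : ℕ).testBit i := by decide +kernel
  have hC : IsFace cuboctahedron cuboctahedron :=
    ⟨.rfl, isPolytope.convex, _, point_mem 0⟩
  refine ⟨fun F hF h1 ↦ ?_, fun e he h2 ↦ ?_, fun e he h2 ↦ ?_, ?_, ?_, ?_⟩
  · obtain ⟨v, hv⟩ := ncard_eq_one.1 h1
    obtain ⟨i, rfl⟩ : v ∈ range point := by
      rw [← extremePoints_eq]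
      exact hF.extremePoints_subset (hv ▸ mem_singleton v)
    refine ⟨(edges.filter fun m ↦ m.testBit i).toFinset.image face, ?_, fun e he ↦ ?_⟩
    · rw [Finset.card_image_of_injOn, List.toFinset_card_of_nodup (nodup_edges.filter _),
        exists_edges]
      intro m hm m' hm' h
      simp only [List.coe_toFinset, List.mem_filter, mem_ofPred_eq] at hm hm'
      refine edges_ext m hm.1 m' hm'.1 fun i ↦ ?_
      rw [Bool.eq_iff_iff, ← (exists_edge m hm.1).2.2, ← (exists_edge m' hm'.1).2.2, h]
    · obtain ⟨m, hm, rfl⟩ := Finset.mem_image.1 he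
      simp only [List.mem_toFinset, List.mem_filter] at hm
      obtain ⟨h3, h4, h5⟩ := exists_edge m hm.1
      refine ⟨h3, h4, hF.subset_of_extremePoints_subset isPolytope h3.convex ?_⟩
      rw [hv, singleton_subset_iff, h5]
      exact hm.2
  · obtain ⟨m, hm, h⟩ := mem_edges he h2
    obtain ⟨m', hm', h'⟩ := exists_triangle m hm
    obtain ⟨h3, h4, h5⟩ :=
      exists_face (exposed_triangles m' hm') (size_triangles m' hm') three_ne_zero
    exact ⟨_, h3, h4, (subset_iff he h3 h h5).2 h'⟩
  · obtain ⟨m, hm, h⟩ := mem_edges he h2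
    obtain ⟨m', hm', h'⟩ := exists_square m hm
    obtain ⟨h3, h4, h5⟩ := exists_face (exposed_squares m' hm') (size_squares m' hm') four_ne_zero
    exact ⟨_, h3, h4, (subset_iff he h3 h h5).2 h'⟩
  · intro e F G he he2 hF hF4 hG hG4 heF heG
    obtain ⟨m, hm, h⟩ := mem_edges he he2
    obtain ⟨mF, hmF, hF'⟩ := mem_squares hF hF4
    obtain ⟨mG, hmG, hG'⟩ := mem_squares hG hG4
    have := square_unique m hm mF hmF mG hmG ((subset_iff he hF h hF').1 heF)
      ((subset_iff he hG h hG').1 heG)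
    subst this
    exact ((subset_iff hF hG hF' hG').2 fun _ ↦ id).antisymm
      ((subset_iff hG hF hG' hF').2 fun _ ↦ id)
  · intro F G H hF hF3 hG hG4 hH hFH hGH
    obtain ⟨mF, hmF, hF'⟩ := mem_triangles hF hF3
    obtain ⟨mG, hmG, hG'⟩ := mem_squares hG hG4
    obtain ⟨mH, hH', h⟩ := classification hH
    have h1 := (subset_iff hF hH hF' hH').1 hFH
    have h2 := (subset_iff hG hH hG' hH').1 hGH
    have hlt : 4 < size mH := (size_triangle_or_square mF hmF mG hmG).trans_le <|
      size_mono fun i hi ↦ by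
        rw [Nat.testBit_or, Bool.or_eq_true] at hi
        exact hi.elim (h1 i) (h2 i)
    rcases h with rfl | h | h | h | h
    · exact hH.isExtreme.subset.antisymm ((subset_iff hC hH (m := 4095)
        (fun i ↦ iff_of_true (point_mem i) (hbit i)) hH').2 fun _ ↦ id)
    · have := size_edges _ h
      omega
    · have := size_triangles _ h
      omega
    · have := size_squares _ h
      omega
    · omega
  · rw [vertexCount_eq_size hC (m := 4095) fun i ↦ iff_of_true (point_mem i) (hbit i), h12]
    norm_num

end Cuboctahedron

section Tiling

theorem IsExtreme.eq_of_mem_interior {E : Type*} [NormedAddCommGroup E] [NormedSpace ℝ E]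
    {T F : Set E} (hF : IsExtreme ℝ T F) {x : E} (hxF : x ∈ F) (hx : x ∈ interior T) : F = T := by
  refine hF.subset.antisymm fun y hy ↦ ?_
  have hlim : Filter.Tendsto (fun t : ℝ ↦ x + t • (x - y)) (nhdsWithin 0 (Ioi 0)) (nhds x) := by
    refine ((Continuous.tendsto' ?_ 0 x (by simp))).mono_left nhdsWithin_le_nhds
    fun_prop
  obtain ⟨t, hz, ht⟩ := ((hlim.eventually (mem_interior_iff_mem_nhds.1 hx)).and
    self_mem_nhdsWithin).exists
  replace ht : 0 < t := ht
  refine hF.left_mem_of_mem_openSegment hy hz hxF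
    ⟨t / (1 + t), 1 / (1 + t), by positivity, by positivity, by field_simp; ring, ?_⟩
  rw [← sub_eq_zero]
  have h1 : t / (1 + t) + 1 / (1 + t) = 1 := by field_simp; ring
  have h2 : 1 / (1 + t) * t = t / (1 + t) := by field_simp
  linear_combination (norm := module) h1 • x + h2 • (x - y)

/-- A locally finite face-to-face tiling of space by polytopes with the combinatorial properties of
the cuboctahedron. -/
structure IsCuboctahedralTiling (𝒯 : Set (Set (Euc 3))) : Prop where
  isTiling : IsTiling 𝒯
  locallyFinite : LocallyFiniteTiling 𝒯
  faceToFace : FaceToFace 𝒯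
  isPolytope : ∀ T ∈ 𝒯, IsPolytope T
  interior_nonempty : ∀ T ∈ 𝒯, (interior T).Nonempty
  isCuboctahedral : ∀ T ∈ 𝒯, IsCuboctahedral T

namespace IsCuboctahedralTiling

variable {𝒯 : Set (Set (Euc 3))} {T T' : Set (Euc 3)}

theorem eq_of_mem_interior (h : IsCuboctahedralTiling 𝒯) (hT : T ∈ 𝒯) (hT' : T' ∈ 𝒯) {x : Euc 3}
    (hx : x ∈ interior T) (hx' : x ∈ interior T') : T = T' := by
  by_contra hne
  exact (h.isTiling.2.2 hT hT' hne).subset ⟨hx, hx'⟩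

theorem eq_of_subset (h : IsCuboctahedralTiling 𝒯) (hT : T ∈ 𝒯) (hT' : T' ∈ 𝒯) (hTT' : T ⊆ T') :
    T = T' := by
  obtain ⟨x, hx⟩ := h.interior_nonempty T hT
  exact h.eq_of_mem_interior hT hT' hx (interior_mono hTT' hx)

theorem finite_setOf_mem (h : IsCuboctahedralTiling 𝒯) (x : Euc 3) :
    {T | T ∈ 𝒯 ∧ x ∈ T}.Finite :=
  (h.locallyFinite {x} isCompact_singleton).subset fun _ hT ↦ ⟨hT.1, x, hT.2, rfl⟩

theorem exists_ne_of_notMem_interior (h : IsCuboctahedralTiling 𝒯) {x : Euc 3}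
    (hx : x ∉ interior T) : ∃ T' ∈ 𝒯, T' ≠ T ∧ x ∈ T' := by
  by_contra! hcon
  have hS := h.locallyFinite _ (isCompact_closedBall x 1)
  set S := {T' ∈ 𝒯 | (T' ∩ Metric.closedBall x 1).Nonempty} with hSdef
  have hS' : (S \ {T}).Finite := hS.subset sdiff_subset
  have hclosed : IsClosed (⋃ T' ∈ S \ {T}, T') :=
    hS'.isClosed_biUnion fun T' hT' ↦ h.isTiling.1 T' hT'.1.1
  refine hx (mem_interior_iff_mem_nhds.2 ?_)
  have hxU : x ∉ ⋃ T' ∈ S \ {T}, T' := by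
    simp only [mem_iUnion, not_exists]
    exact fun T' hT' ↦ hcon T' hT'.1.1 hT'.2
  filter_upwards [hclosed.isOpen_compl.mem_nhds hxU, Metric.closedBall_mem_nhds x one_pos]
    with y hy hyx
  obtain ⟨T', hT', hyT'⟩ : y ∈ ⋃₀ 𝒯 := h.isTiling.2.1 ▸ mem_univ y
  by_contra hyT
  refine hy (mem_biUnion (x := T') ⟨⟨hT', y, hyT', hyx⟩, ?_⟩ hyT')
  rintro rfl
  exact hyT hyT'

theorem exists_neighbor (h : IsCuboctahedralTiling 𝒯) (hT : T ∈ 𝒯) {F : Set (Euc 3)}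
    (hF : IsFace T F) (hne : F ≠ T) : ∃ T' ∈ 𝒯, T' ≠ T ∧ F ⊆ T' := by
  obtain ⟨x, hxF, hx⟩ :=
    (hF.isPolytope (h.isPolytope T hT)).exists_forall_mem_openSegment hF.nonempty
  obtain ⟨T', hT', hne', hxT'⟩ := h.exists_ne_of_notMem_interior (T := T) (x := x)
    fun hxT ↦ hne (hF.isExtreme.eq_of_mem_interior hxF hxT)
  refine ⟨T', hT', hne', (IsExtreme.subset_of_forall_mem_openSegment
    (h.faceToFace T hT T' hT' hne'.symm).1 hF.isExtreme.subset hx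
    ⟨hF.isExtreme.subset hxF, hxT'⟩).trans inter_subset_right⟩

theorem isFace_of_subset (h : IsCuboctahedralTiling 𝒯) (hT : T ∈ 𝒯) (hT' : T' ∈ 𝒯)
    {F : Set (Euc 3)} (hF : IsFace T F) (hFT' : F ⊆ T') : IsFace T' F := by
  rcases eq_or_ne T T' with rfl | hne
  · exact hF
  · exact ⟨(h.faceToFace T hT T' hT' hne).2.trans (hF.isExtreme.mono inter_subset_left
      (subset_inter hF.isExtreme.subset hFT')), hF.convex, hF.nonempty⟩

theorem not_subset_of_subset (h : IsCuboctahedralTiling 𝒯) (hT : T ∈ 𝒯) (hT' : T' ∈ 𝒯)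
    (hne : T ≠ T') {F G : Set (Euc 3)} (hF : IsFace T F) (hF3 : vertexCount F = 3)
    (hG : IsFace T G) (hG4 : vertexCount G = 4) (hFT' : F ⊆ T') : ¬ G ⊆ T' := by
  intro hGT'
  have hFTT' := subset_inter hF.isExtreme.subset hFT'
  have hface : IsFace T (T ∩ T') := ⟨(h.faceToFace T hT T' hT' hne).1,
    (h.isPolytope T hT).convex.inter (h.isPolytope T' hT').convex, hF.nonempty.mono hFTT'⟩
  have := (h.isCuboctahedral T hT).eq_of_subset F G _ hF hF3 hG hG4 hface hFTT'
    (subset_inter hG.isExtreme.subset hGT')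
  exact hne (h.eq_of_subset hT hT' (this.superset.trans inter_subset_right))

theorem exists_four_tiles (h : IsCuboctahedralTiling 𝒯) (hT : T ∈ 𝒯) {e : Set (Euc 3)}
    (he : IsFace T e) (he2 : vertexCount e = 2) :
    ∃ S : Finset (Set (Euc 3)), S.card = 4 ∧ ∀ T ∈ S, T ∈ 𝒯 ∧ e ⊆ T := by
  classical
  have hcub := h.isCuboctahedral
  have hlt : ∀ {T F : Set (Euc 3)}, T ∈ 𝒯 → vertexCount F ≤ 4 → F ≠ T := by
    rintro T F hT hF4 rfl
    exact hF4.not_gt (hcub F hT).lt_vertexCount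
  obtain ⟨F, hF, hF3, heF⟩ := (hcub T hT).triangle e he he2
  obtain ⟨G, hG, hG4, heG⟩ := (hcub T hT).square e he he2
  obtain ⟨T₁, hT₁, hne₁, hFT₁⟩ := h.exists_neighbor hT hF (hlt hT (by omega))
  obtain ⟨T₂, hT₂, hne₂, hGT₂⟩ := h.exists_neighbor hT hG (hlt hT (by omega))
  have heT₁ := h.isFace_of_subset hT hT₁ he (heF.trans hFT₁)
  obtain ⟨G', hG', hG4', heG'⟩ := (hcub T₁ hT₁).square e heT₁ he2
  obtain ⟨T₃, hT₃, hne₃, hGT₃⟩ := h.exists_neighbor hT₁ hG' (hlt hT₁ (by omega))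
  have hGT : ¬ G' ⊆ T := h.not_subset_of_subset hT₁ hT hne₁ (h.isFace_of_subset hT hT₁ hF hFT₁)
    hF3 hG' hG4' hF.isExtreme.subset
  have h12 : T₁ ≠ T₂ := by
    rintro rfl
    exact h.not_subset_of_subset hT hT₁ hne₁.symm hF hF3 hG hG4 hFT₁ hGT₂
  have h03 : T ≠ T₃ := by
    rintro rfl
    exact hGT hGT₃
  have h23 : T₂ ≠ T₃ := by
    rintro rfl
    have := (hcub T₂ hT₂).square_unique e G G' (h.isFace_of_subset hT hT₂ he (heG.trans hGT₂)) he2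
      (h.isFace_of_subset hT hT₂ hG hGT₂) hG4 (h.isFace_of_subset hT₁ hT₂ hG' hGT₃) hG4' heG heG'
    exact hGT (this ▸ hG.isExtreme.subset)
  refine ⟨{T, T₁, T₂, T₃}, ?_, ?_⟩
  · rw [Finset.card_insert_of_notMem (by simp [hne₁.symm, hne₂.symm, h03]),
      Finset.card_insert_of_notMem (by simp [h12, hne₃.symm]), Finset.card_pair h23]
  · simp only [Finset.mem_insert, Finset.mem_singleton]
    rintro _ (rfl | rfl | rfl | rfl)
    exacts [⟨hT, he.isExtreme.subset⟩, ⟨hT₁, heF.trans hFT₁⟩, ⟨hT₂, heG.trans hGT₂⟩,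
      ⟨hT₃, heG'.trans hGT₃⟩]

end IsCuboctahedralTiling

/-- A line missing the interior of a convex body lies in a supporting hyperplane, if it passes
through the midpoint of a segment in the body. -/
theorem exists_functional {E : Type*} [NormedAddCommGroup E] [NormedSpace ℝ E] {T : Set E}
    (hT : Convex ℝ T) (hTi : (interior T).Nonempty) {v w u : E} (hv : v ∈ T) (hw : w ∈ T)
    (h : ∀ t : ℝ, midpoint ℝ v w + t • u ∉ interior T) :
    ∃ f : E →L[ℝ] ℝ, f u = 0 ∧ f v = f w ∧ (∀ x ∈ T, f x ≤ f v) ∧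
      ∀ x ∈ interior T, f x < f v := by
  set m := midpoint ℝ v w with hm
  have hline : Convex ℝ (range fun t : ℝ ↦ m + t • u) := by
    have : (range fun t : ℝ ↦ m + t • u) = AffineMap.lineMap (k := ℝ) m (m + u) '' univ := by
      rw [image_univ]
      congr 1
      ext t
      simp [AffineMap.lineMap_apply, add_comm]
    rw [this]
    exact convex_univ.affine_image _
  obtain ⟨f, s, hlt, hle⟩ := geometric_hahn_banach_open hT.interior isOpen_interior hline
    (Set.disjoint_left.2 fun x hx ⟨t, ht⟩ ↦ h t (by rwa [← ht] at hx))
  have hle' : ∀ t : ℝ, s ≤ f m + t * f u := fun t ↦ by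
    simpa using hle _ ⟨t, rfl⟩
  have hT' : ∀ x ∈ T, f x ≤ s := fun x hx ↦ by
    have hx' : x ∈ closure (interior T) := by
      rw [hT.closure_interior_eq_closure_of_nonempty_interior hTi]
      exact subset_closure hx
    exact closure_minimal (fun a ha ↦ (hlt a ha).le)
      (isClosed_le f.continuous continuous_const) hx'
  have hu : f u = 0 := by
    by_contra hne
    have := hle' ((s - f m - 1) / f u)
    rw [div_mul_cancel₀ _ hne] at this
    linarith
  have hmid : f m = (f v + f w) / 2 := by
    rw [hm, midpoint_eq_smul_add, map_smul, map_add, smul_eq_mul, invOf_eq_inv]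
    ring
  have h0 := hle' 0
  have h1 := hT' v hv
  have h2 := hT' w hw
  have hvs : f v = s := by linarith
  exact ⟨f, hu, by linarith, hvs ▸ hT', hvs ▸ hlt⟩

theorem eq_zero_of_mul_add_mul_eq_zero {a b c p q r s t x : ℝ} (hp : p < 0) (hq : q < 0)
    (hr : r < 0) (hs : s < 0) (ht : t < 0) (hx : x < 0) (h1 : b * p + c * q = 0)
    (h2 : a * r + c * s = 0) (h3 : a * t + b * x = 0) : a = 0 ∧ b = 0 ∧ c = 0 := by
  have key : ∀ {b c p q : ℝ}, p < 0 → q < 0 → b * p + c * q = 0 → 0 < b → c < 0 := by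
    intro b c p q hp hq h hb
    by_contra! hc
    nlinarith [mul_neg_of_pos_of_neg hb hp, mul_nonpos_of_nonneg_of_nonpos hc hq.le]
  have key' : ∀ {b c p q : ℝ}, p < 0 → q < 0 → b * p + c * q = 0 → b < 0 → 0 < c := by
    intro b c p q hp hq h hb
    have := key hp hq (b := -b) (c := -c) (by linarith) (by linarith)
    linarith
  have ha : a = 0 := by
    rcases lt_trichotomy a 0 with ha | ha | ha
    · have hc := key' hr hs h2 ha
      have hb := key' ht hx h3 ha
      have := key hp hq h1 hb
      linarith
    · exact ha
    · have hc := key hr hs h2 ha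
      have hb := key ht hx h3 ha
      have := key' hp hq h1 hb
      linarith
  subst ha
  refine ⟨rfl, ?_, ?_⟩
  · simpa [hx.ne] using h3
  · simpa [hs.ne] using h2

/-- If `v`, `w 0`, `w 1`, `w 2` belong to a convex body and `u` is in general position, then the
line in the direction `u` through the midpoint of `v` and some `w i` meets the interior. -/
theorem exists_mem_interior_of_three {T : Set (Euc 3)} (hT : Convex ℝ T)
    (hTi : (interior T).Nonempty) {v u : Euc 3} {w : Fin 3 → Euc 3} (hv : v ∈ T)
    (hw : ∀ i, w i ∈ T) (hli : ∀ i j, i ≠ j → LinearIndependent ℝ ![u, w i - v, w j - v]) :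
    ∃ i, ∃ t : ℝ, midpoint ℝ v (w i) + t • u ∈ interior T := by
  by_contra! hcon
  choose f hfu hfw hfle hflt using fun i ↦ exists_functional hT hTi hv (hw i) (hcon i)
  obtain ⟨x, hx⟩ := hTi
  have hneg : ∀ i j, i ≠ j → f i (w j - v) < 0 := by
    intro i j hij
    refine lt_of_le_of_ne (by simpa using hfle i _ (hw j)) fun h0 ↦ ?_
    have hspan := (hli i j hij).span_eq_top_of_card_eq_finrank' (by simp)
    have h0 : (f i : Euc 3 →ₗ[ℝ] ℝ) = 0 := LinearMap.ext_on_range hspan fun k ↦ by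
      have h1 : f i (w i - v) = 0 := by simp [hfw i]
      fin_cases k
      exacts [hfu i, h1, h0]
    have h1 := hflt i x hx
    have h2 : ∀ y, f i y = 0 := fun y ↦ LinearMap.congr_fun h0 y
    rw [h2, h2] at h1
    exact h1.false
  have hself : ∀ i, f i (w i - v) = 0 := fun i ↦ by simp [hfw i]
  have hdep : ¬ LinearIndependent ℝ ![w 0 - v, w 1 - v, w 2 - v, u] := fun hli ↦ by
    simpa using hli.fintype_card_le_finrank
  obtain ⟨g, hg, k, hk⟩ := Fintype.not_linearIndependent_iff.1 hdep
  simp only [Fin.sum_univ_four, Matrix.cons_val] at hg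
  have hf : ∀ i, g 0 * f i (w 0 - v) + g 1 * f i (w 1 - v) + g 2 * f i (w 2 - v) = 0 := fun i ↦ by
    simpa only [map_add, map_smul, hfu, smul_eq_mul, mul_zero, add_zero, map_zero] using
      congrArg (f i) hg
  have h0 := hf 0
  have h1 := hf 1
  have h2 := hf 2
  rw [hself, mul_zero, zero_add] at h0
  rw [hself, mul_zero, add_zero] at h1
  rw [hself, mul_zero, add_zero] at h2
  obtain ⟨ha, hb, hc⟩ := eq_zero_of_mul_add_mul_eq_zero (hneg 0 1 (by decide))
    (hneg 0 2 (by decide)) (hneg 1 0 (by decide)) (hneg 1 2 (by decide)) (hneg 2 0 (by decide))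
    (hneg 2 1 (by decide)) h0 h1 h2
  have hu : u ≠ 0 := (hli 0 1 (by decide)).ne_zero 0
  rw [ha, hb, hc, zero_smul, zero_smul, zero_smul, add_zero, add_zero, zero_add,
    smul_eq_zero_iff_left hu] at hg
  fin_cases k
  exacts [hk ha, hk hb, hk hc, hk hg]

theorem linearIndependent_of_mem_extremePoints {E : Type*} [NormedAddCommGroup E]
    [NormedSpace ℝ E] {T : Set E} {v a b : E} (hv : v ∈ T.extremePoints ℝ)
    (ha : a ∈ T.extremePoints ℝ) (hb : b ∈ T.extremePoints ℝ) (hva : a ≠ v) (hvb : b ≠ v)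
    (hab : a ≠ b) : LinearIndependent ℝ ![a - v, b - v] := by
  have key : ∀ x y z : E, x ∈ T.extremePoints ℝ → y ∈ T.extremePoints ℝ →
      z ∈ T.extremePoints ℝ → x ≠ y → x ≠ z → y ≠ z → ¬ Wbtw ℝ x y z := by
    intro x y z hx hy hz hxy hxz hyz h
    have h' : y ∈ openSegment ℝ x z := by
      rw [openSegment_eq_image_lineMap]
      exact (sbtw_iff_mem_image_Ioo_and_ne.1 ⟨h, hxy.symm, hyz⟩).1
    exact hxy ((mem_extremePoints_iff_left.1 hy).2 x hx.1 z hz.1 h')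
  rw [LinearIndependent.pair_iff' (sub_ne_zero.2 hva)]
  intro s hs
  have hcol : Collinear ℝ {v, a, b} := by
    rw [collinear_iff_of_mem (p₀ := v) (by simp)]
    refine ⟨a - v, ?_⟩
    simp only [mem_insert_iff, mem_singleton_iff, forall_eq_or_imp, forall_eq]
    exact ⟨⟨0, by simp⟩, ⟨1, by simp⟩, s, by simp [hs]⟩
  rcases hcol.wbtw_or_wbtw_or_wbtw with h | h | h
  · exact key _ _ _ hv ha hb hva.symm hvb.symm hab h
  · exact key _ _ _ ha hb hv hab hva hvb h
  · exact key _ _ _ hb hv ha hvb hab.symm hva.symm h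

/-- A nonempty open set contains a translate of a vector avoiding the planes spanned by any two
vectors of a finite set. -/
theorem exists_generic {R : Set (Euc 3)} (hR : R.Finite) {U : Set (Euc 3)} (hU : IsOpen U)
    (hne : U.Nonempty) (v : Euc 3) :
    ∃ u, v + u ∈ U ∧ ∀ a ∈ R, ∀ b ∈ R, u ∉ Submodule.span ℝ {a, b} := by
  have hnull : MeasureTheory.volume (⋃ p ∈ R ×ˢ R,
      (Submodule.span ℝ {p.1, p.2} : Set (Euc 3))) = 0 := by
    refine (MeasureTheory.measure_biUnion_null_iff (hR.prod hR).countable).2 fun p _ ↦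
      MeasureTheory.Measure.addHaar_submodule _ _ fun htop ↦ ?_
    classical
    have h := finrank_span_finset_le_card (R := ℝ) ({p.1, p.2} : Finset (Euc 3))
    rw [Set.finrank, Finset.coe_pair, htop, finrank_top, finrank_euclideanSpace_fin] at h
    exact absurd (h.trans Finset.card_le_two) (by norm_num)
  have hpos : 0 < MeasureTheory.volume ((fun u ↦ v + u) ⁻¹' U) := by
    refine (hU.preimage (by fun_prop)).measure_pos _ ?_
    obtain ⟨x, hx⟩ := hne
    exact ⟨x - v, by simpa using hx⟩
  obtain ⟨u, huU, hu⟩ := MeasureTheory.nonempty_of_measure_ne_zero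
    ((MeasureTheory.measure_sdiff_null hnull).trans_ne hpos.ne')
  refine ⟨u, huU, fun a ha b hb h ↦ hu ?_⟩
  exact mem_biUnion (x := (a, b)) ⟨ha, hb⟩ h

namespace IsCuboctahedralTiling

variable {𝒯 : Set (Set (Euc 3))}

/-- An open ray from a common point of tiles enters the interior of at most one of them right
away. -/
theorem eq_of_smul_mem_interior (h : IsCuboctahedralTiling 𝒯) {T T' : Set (Euc 3)} (hT : T ∈ 𝒯)
    (hT' : T' ∈ 𝒯) {m u : Euc 3} (hm : m ∈ T) (hm' : m ∈ T') {s t : ℝ} (hs : 0 < s) (ht : 0 < t)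
    (hsT : m + s • u ∈ interior T) (htT' : m + t • u ∈ interior T') : T = T' := by
  wlog hst : s ≤ t generalizing s t T T'
  · exact (this hT' hT hm' hm ht hs htT' hsT (le_of_not_ge hst)).symm
  have := (h.isPolytope T' hT').convex.add_smul_mem_interior hm' htT'
    (t := s / t) ⟨by positivity, (div_le_one ht).2 hst⟩
  rw [smul_smul, div_mul_cancel₀ _ ht.ne'] at this
  exact h.eq_of_mem_interior hT hT' hsT this

theorem card_le_two (h : IsCuboctahedralTiling 𝒯) {S : Finset (Set (Euc 3))} {m u : Euc 3}
    (hS : ∀ T ∈ S, T ∈ 𝒯 ∧ m ∈ T ∧ ∃ t : ℝ, m + t • u ∈ interior T) : S.card ≤ 2 := by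
  classical
  have hcard : ∀ u, (S.filter fun T ↦ ∃ t : ℝ, 0 < t ∧ m + t • u ∈ interior T).card ≤ 1 := by
    refine fun u ↦ Finset.card_le_one.2 fun T hT T' hT' ↦ ?_
    obtain ⟨hTS, s, hs, hsT⟩ := Finset.mem_filter.1 hT
    obtain ⟨hTS', t, ht, htT⟩ := Finset.mem_filter.1 hT'
    exact h.eq_of_smul_mem_interior (hS T hTS).1 (hS T' hTS').1 (hS T hTS).2.1 (hS T' hTS').2.1
      hs ht hsT htT
  refine (Finset.card_le_card (t := S.filter (fun T ↦ ∃ t : ℝ, 0 < t ∧ m + t • u ∈ interior T) ∪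
    S.filter fun T ↦ ∃ t : ℝ, 0 < t ∧ m + t • (-u) ∈ interior T) fun T hT ↦ ?_).trans
    ((Finset.card_union_le _ _).trans (add_le_add (hcard u) (hcard (-u))))
  simp only [Finset.mem_union, Finset.mem_filter, hT, true_and]
  obtain ⟨t, ht⟩ := (hS T hT).2.2
  rcases lt_trichotomy t 0 with h0 | rfl | h0
  · exact .inr ⟨-t, neg_pos.2 h0, by rwa [neg_smul_neg]⟩
  · rw [zero_smul, add_zero] at ht
    have hlim : Filter.Tendsto (fun t : ℝ ↦ m + t • u) (nhdsWithin 0 (Ioi 0)) (nhds m) := by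
      refine (Continuous.tendsto' ?_ 0 m (by simp)).mono_left nhdsWithin_le_nhds
      fun_prop
    obtain ⟨t, htT, ht0⟩ := ((hlim.eventually (isOpen_interior.mem_nhds ht)).and
      self_mem_nhdsWithin).exists
    exact .inl ⟨t, ht0, htT⟩
  · exact .inl ⟨t, h0, ht⟩

theorem false (h : IsCuboctahedralTiling 𝒯) : False := by
  classical
  obtain ⟨T₀, hT₀, -⟩ : (0 : Euc 3) ∈ ⋃₀ 𝒯 := h.isTiling.2.1 ▸ mem_univ _
  obtain ⟨v, hv⟩ := (h.isPolytope T₀ hT₀).nonempty_extremePoints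
    ((h.interior_nonempty T₀ hT₀).mono interior_subset)
  obtain ⟨tiles, htiles⟩ : ∃ tiles : Finset (Set (Euc 3)), ∀ T, T ∈ tiles ↔ T ∈ 𝒯 ∧ v ∈ T :=
    ⟨(h.finite_setOf_mem v).toFinset, by simp⟩
  have hext : ∀ T ∈ tiles, v ∈ T.extremePoints ℝ := fun T hT ↦ isExtreme_singleton.1
    (h.isFace_of_subset hT₀ ((htiles T).1 hT).1 (isFace_singleton hv)
      (singleton_subset_iff.2 ((htiles T).1 hT).2)).isExtreme
  obtain ⟨edges, hedges⟩ : ∃ edges : Finset (Set (Euc 3)), ∀ e, e ∈ edges ↔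
      ∃ T ∈ tiles, IsFace T e ∧ vertexCount e = 2 ∧ v ∈ e := by
    have hfin : (⋃ T ∈ tiles, {e | IsFace T e}).Finite :=
      tiles.finite_toSet.biUnion fun T hT ↦ (h.isPolytope T ((htiles T).1 hT).1).finite_isFace
    have hfin' : {e | ∃ T ∈ tiles, IsFace T e ∧ vertexCount e = 2 ∧ v ∈ e}.Finite := by
      refine hfin.subset ?_
      rintro e ⟨T, hT, he, -⟩
      exact mem_biUnion (x := T) hT he
    exact ⟨hfin'.toFinset, by simp⟩
  have hface : ∀ T ∈ tiles, ∀ e ∈ edges, e ⊆ T → IsFace T e := fun T hT e he heT ↦ by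
    obtain ⟨T', hT', he', -⟩ := (hedges e).1 he
    exact h.isFace_of_subset ((htiles T').1 hT').1 ((htiles T).1 hT).1 he' heT
  have hend : ∀ e ∈ edges, ∃ w, w ≠ v ∧ e.extremePoints ℝ = {v, w} ∧ convexHull ℝ {v, w} = e := by
    intro e he
    obtain ⟨T, hT, heT, he2, hve⟩ := (hedges e).1 he
    have hve' : v ∈ e.extremePoints ℝ := by
      rw [heT.isExtreme.extremePoints_eq]
      exact ⟨hve, hext T hT⟩
    obtain ⟨x, y, hxy, hext'⟩ := ncard_eq_two.1 he2
    have hhull := (heT.isPolytope (h.isPolytope T ((htiles T).1 hT).1)).convexHull_extremePoints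
    rw [hext'] at hve' hhull
    rcases hve' with rfl | rfl
    · exact ⟨y, hxy.symm, hext', hhull⟩
    · exact ⟨x, hxy, hext'.trans (pair_comm _ _), pair_comm x v ▸ hhull⟩
  choose! w hwv hwext hwhull using hend
  have hwmem : ∀ e ∈ edges, v ∈ e ∧ w e ∈ e := fun e he ↦ by
    have := (hwext e he).superset.trans extremePoints_subset
    exact ⟨this (by simp), this (by simp)⟩
  obtain ⟨u, hu, hgen⟩ := exists_generic ((edges.image fun e ↦ w e - v).finite_toSet)
    isOpen_interior (h.interior_nonempty T₀ hT₀) v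
  have hT₀' : T₀ ∈ tiles := (htiles T₀).2 ⟨hT₀, hv.1⟩
  -- The edge `e` is not on the silhouette of the tile `T`.
  let visible (T e : Set (Euc 3)) : Prop := ∃ t : ℝ, midpoint ℝ v (w e) + t • u ∈ interior T
  have hvisible : ∀ e ∈ edges, ((tiles.filter (e ⊆ ·)).filter (visible · e)).card ≤ 2 := by
    intro e he
    refine h.card_le_two (m := midpoint ℝ v (w e)) (u := u) fun T hT ↦ ?_
    simp only [Finset.mem_filter] at hT
    refine ⟨((htiles T).1 hT.1.1).1, ?_, hT.2⟩
    exact hT.1.2 ((hface T hT.1.1 e he hT.1.2).convex.midpoint_mem (hwmem e he).1 (hwmem e he).2)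
  have hsilhouette : ∀ T ∈ tiles,
      ((edges.filter (· ⊆ T)).filter (¬ visible T ·)).card ≤ 2 := by
    intro T hT
    by_contra! hlt
    obtain ⟨a, ha, b, hb, c, hc, hab, hac, hbc⟩ := Finset.two_lt_card.1 hlt
    simp only [Finset.mem_filter] at ha hb hc
    have hwext' : ∀ e ∈ edges, e ⊆ T → w e ∈ T.extremePoints ℝ := fun e he heT ↦
      (hface T hT e he heT).extremePoints_subset ((hwext e he).superset (by simp))
    let e : Fin 3 → Set (Euc 3) := ![a, b, c]
    have he : ∀ i, (e i ∈ edges ∧ e i ⊆ T) ∧ ¬ visible T (e i) := by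
      simpa [e, Fin.forall_fin_succ] using ⟨ha, hb, hc⟩
    have hinj : ∀ i j, i ≠ j → e i ≠ e j := by
      simp [e, Fin.forall_fin_succ, hab, hac, hbc, hab.symm, hac.symm, hbc.symm]
    obtain ⟨i, hi⟩ := exists_mem_interior_of_three (w := fun i ↦ w (e i)) (u := u)
      (h.isPolytope T ((htiles T).1 hT).1).convex (h.interior_nonempty T ((htiles T).1 hT).1)
      (hext T hT).1 (fun i ↦ (hwext' _ (he i).1.1 (he i).1.2).1) fun i j hij ↦ by
        refine linearIndependent_finCons.2 ⟨linearIndependent_of_mem_extremePoints (hext T hT)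
          (hwext' _ (he i).1.1 (he i).1.2) (hwext' _ (he j).1.1 (he j).1.2) (hwv _ (he i).1.1)
          (hwv _ (he j).1.1) fun hw ↦ hinj i j hij ?_, ?_⟩
        · rw [← hwhull _ (he i).1.1, ← hwhull _ (he j).1.1, hw]
        · rw [Matrix.range_cons, Matrix.range_cons, Matrix.range_empty, union_empty]
          refine hgen _ ?_ _ ?_
          · exact Finset.mem_coe.2 (Finset.mem_image_of_mem _ (he i).1.1)
          · exact Finset.mem_coe.2 (Finset.mem_image_of_mem _ (he j).1.1)
    exact (he i).2 hi
  have hsilhouette₀ : ((edges.filter (· ⊆ T₀)).filter (¬ visible T₀ ·)).card = 0 := by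
    refine Finset.card_eq_zero.2 (Finset.filter_eq_empty_iff.2 fun e he hcon ↦ ?_)
    obtain ⟨he, heT⟩ := Finset.mem_filter.1 he
    obtain ⟨f, hfu, -, -, hf⟩ := exists_functional (h.isPolytope T₀ hT₀).convex
      (h.interior_nonempty T₀ hT₀) hv.1 (heT (hwmem e he).2) (not_exists.1 hcon)
    have := hf _ hu
    rw [map_add, hfu, add_zero] at this
    exact this.false
  have htiles4 : ∀ e ∈ edges, 4 ≤ (tiles.filter (e ⊆ ·)).card := by
    intro e he
    obtain ⟨T, hT, heT, he2, hve⟩ := (hedges e).1 he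
    obtain ⟨S, hS, hS'⟩ := h.exists_four_tiles ((htiles T).1 hT).1 heT he2
    exact hS ▸ Finset.card_le_card fun T hT ↦ Finset.mem_filter.2
      ⟨(htiles T).2 ⟨(hS' T hT).1, (hS' T hT).2 hve⟩, (hS' T hT).2⟩
  have hedges4 : ∀ T ∈ tiles, 4 ≤ (edges.filter (· ⊆ T)).card := by
    intro T hT
    obtain ⟨S, hS, hS'⟩ := (h.isCuboctahedral T ((htiles T).1 hT).1).edges {v}
      (isFace_singleton (hext T hT)) (by simp [vertexCount])
    refine hS ▸ Finset.card_le_card fun e he ↦ Finset.mem_filter.2 ⟨(hedges e).2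
      ⟨T, hT, (hS' e he).1, (hS' e he).2.1, singleton_subset_iff.1 (hS' e he).2.2⟩,
      (hS' e he).1.isExtreme.subset⟩
  have hcount : ∑ e ∈ edges, (tiles.filter (e ⊆ ·)).card =
      ∑ T ∈ tiles, (edges.filter (· ⊆ T)).card :=
    Finset.sum_card_bipartiteAbove_eq_sum_card_bipartiteBelow _
  have hcount' : ∑ e ∈ edges, ((tiles.filter (e ⊆ ·)).filter (visible · e)).card =
      ∑ T ∈ tiles, ((edges.filter (· ⊆ T)).filter (visible T ·)).card := by
    simp only [Finset.filter_filter]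
    exact Finset.sum_card_bipartiteAbove_eq_sum_card_bipartiteBelow fun e T ↦ e ⊆ T ∧ visible T e
  have hsplit : ∑ T ∈ tiles, (edges.filter (· ⊆ T)).card =
      ∑ T ∈ tiles, ((edges.filter (· ⊆ T)).filter (visible T ·)).card +
        ∑ T ∈ tiles, ((edges.filter (· ⊆ T)).filter (¬ visible T ·)).card := by
    rw [← Finset.sum_add_distrib]
    exact Finset.sum_congr rfl fun T _ ↦ (Finset.card_filter_add_card_filter_not _).symm
  have h1 := Finset.sum_le_card_nsmul edges _ 2 hvisible
  have h2 := Finset.sum_le_card_nsmul (tiles.erase T₀) _ 2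
    fun T hT ↦ hsilhouette T (Finset.mem_of_mem_erase hT)
  have h3 := Finset.card_nsmul_le_sum edges _ 4 htiles4
  have h4 := Finset.card_nsmul_le_sum tiles _ 4 hedges4
  have h5 := Finset.add_sum_erase tiles
    (fun T ↦ ((edges.filter (· ⊆ T)).filter (¬ visible T ·)).card) hT₀'
  simp only [hsilhouette₀, zero_add] at h5
  have h6 := Finset.card_erase_add_one hT₀'
  simp only [smul_eq_mul] at h1 h2 h3 h4
  omega

end IsCuboctahedralTiling

end Tiling

/-- the cuboctahedron is a nontile: there is no locally finite
monotypic face-to-face tiling of `ℝ³` by convex polytopes combinatorially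
equivalent to it. -/
theorem cuboctahedron_is_nontile :
    ¬ ∃ 𝒯 : Set (Set (Euc 3)), IsTiling 𝒯 ∧ LocallyFiniteTiling 𝒯 ∧ FaceToFace 𝒯 ∧
        ∀ T ∈ 𝒯, IsConvexPolytope T ∧ CombEquiv T cuboctahedron := by
  rintro ⟨𝒯, h₁, h₂, h₃, h₄⟩
  refine IsCuboctahedralTiling.false ⟨h₁, h₂, h₃, fun T hT ↦ (h₄ T hT).1.1,
    fun T hT ↦ (h₄ T hT).1.2, fun T hT ↦ ?_⟩
  obtain ⟨φ⟩ := (h₄ T hT).2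
  exact .of_orderIso (h₄ T hT).1.1 Cuboctahedron.isPolytope φ Cuboctahedron.isCuboctahedral
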